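/- (Differential equation (A10) for the coordinate functions x, y, z of the Ree curve.) For each p ∈ {p_x, p_y, p_z}, the identity ℓ^(2q) * (ℓ * D^(q*q0+2q) p - D^(q*q0+1) p) = (ℓ^q - ℓ) * (ℓ^q * D^(q*q0+q) p + D^(q*q0) p) holds in F[X]. -/

import Mathlib

noncomputable section

open Polynomial

abbrev F := ZMod 3

def q0 (s : ℕ) : ℕ := 3 ^ s
def q (s : ℕ) : ℕ := 3 ^ (2 * s + 1)

def pX : Polynomial F := X
def pY (s : ℕ) : Polynomial F :=
  X ^ (q0 s + 1) - X ^ (q s + q0 s) + X ^ (q s * (q0 s + 1)) - X ^ (q s * (q s + q0 s))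
def pZ (s : ℕ) : Polynomial F :=
  X ^ (2 * q0 s + 1) - X ^ (q s + 2 * q0 s) + X ^ (q s * (2 * q0 s + 1)) - X ^ (q s * (q s + 2 * q0 s))
def ell (s : ℕ) : Polynomial F := X ^ q s - X

theorem hd_X_pow (n m : ℕ) : hasseDeriv n (X ^ m : Polynomial F)
    = (((X : Polynomial (Polynomial F)) + C X) ^ m).coeff n := by
  rw [coeff_X_add_C_pow, X_pow_eq_monomial, hasseDeriv_monomial, ← C_mul_X_pow_eq_monomial]
  simp [mul_comm]

theorem frob (k : ℕ) : ((X : Polynomial (Polynomial F)) + C X) ^ (3 ^ k)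
    = X ^ (3 ^ k) + C (X ^ (3 ^ k)) := by
  rw [add_pow_char_pow, C_pow]

/-- Coefficients of a product of a binomial and a binomial. -/
theorem coeff_prod1 (a b n : ℕ) (u v : Polynomial F) :
    (((X : Polynomial (Polynomial F)) ^ a + C u) * (X ^ b + C v)).coeff n
    = (if n = a + b then 1 else 0) + v * (if n = a then 1 else 0)
      + u * (if n = b then 1 else 0) + u * v * (if n = 0 then 1 else 0) := by
  have : ((X : Polynomial (Polynomial F)) ^ a + C u) * (X ^ b + C v)
    = X ^ (a + b) + C v * X ^ a + C u * X ^ b + C (u * v) * X ^ 0 := by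
    simp only [C_mul]; ring
  rw [this]
  simp only [coeff_add, coeff_C_mul, coeff_X_pow]

theorem coeff_prod2 (a b n : ℕ) (u v : Polynomial F) :
    (((X : Polynomial (Polynomial F)) ^ a + C u) ^ 2 * (X ^ b + C v)).coeff n
    = (if n = 2 * a + b then 1 else 0) + v * (if n = 2 * a then 1 else 0)
      + 2 * u * (if n = a + b then 1 else 0) + 2 * u * v * (if n = a then 1 else 0)
      + u ^ 2 * (if n = b then 1 else 0) + u ^ 2 * v * (if n = 0 then 1 else 0) := by
  have : ((X : Polynomial (Polynomial F)) ^ a + C u) ^ 2 * (X ^ b + C v)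
    = X ^ (2 * a + b) + C v * X ^ (2 * a) + C (2 * u) * X ^ (a + b) + C (2 * u * v) * X ^ a
      + C (u ^ 2) * X ^ b + C (u ^ 2 * v) * X ^ 0 := by
    simp only [C_mul, C_pow, map_ofNat]; ring
  rw [this]
  simp only [coeff_add, coeff_C_mul, coeff_X_pow]

theorem hd1 (i j n : ℕ) : hasseDeriv n (X ^ (3 ^ i + 3 ^ j) : Polynomial F)
    = (if n = 3 ^ i + 3 ^ j then 1 else 0) + X ^ (3 ^ j) * (if n = 3 ^ i then 1 else 0)
      + X ^ (3 ^ i) * (if n = 3 ^ j then 1 else 0)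
      + X ^ (3 ^ i) * X ^ (3 ^ j) * (if n = 0 then 1 else 0) := by
  rw [hd_X_pow, pow_add, frob, frob, coeff_prod1]

theorem hd2 (i j n : ℕ) : hasseDeriv n (X ^ (2 * 3 ^ i + 3 ^ j) : Polynomial F)
    = (if n = 2 * 3 ^ i + 3 ^ j then 1 else 0) + X ^ (3 ^ j) * (if n = 2 * 3 ^ i then 1 else 0)
      + 2 * X ^ (3 ^ i) * (if n = 3 ^ i + 3 ^ j then 1 else 0)
      + 2 * X ^ (3 ^ i) * X ^ (3 ^ j) * (if n = 3 ^ i then 1 else 0)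
      + (X ^ (3 ^ i)) ^ 2 * (if n = 3 ^ j then 1 else 0)
      + (X ^ (3 ^ i)) ^ 2 * X ^ (3 ^ j) * (if n = 0 then 1 else 0) := by
  rw [hd_X_pow, pow_add, mul_comm 2 (3 ^ i), pow_mul, frob, frob, coeff_prod2, mul_comm 2 (3 ^ i)]

theorem ell_pow (s : ℕ) : ell s ^ q s = X ^ (q s * q s) - X ^ q s := by
  rw [ell]
  conv_lhs => rw [q]
  rw [sub_pow_char_pow, ← pow_mul]; rfl

theorem arith (s : ℕ) (hs : 1 ≤ s) : 3 ≤ 3 ^ s ∧ 9 * 3 ^ s ≤ 3 ^ (2 * s + 1) ∧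
    3 * 3 ^ (2 * s + 1) ≤ 3 ^ (2 * s + 1 + s) ∧
    3 * 3 ^ (2 * s + 1 + s) ≤ 3 ^ (2 * s + 1 + (2 * s + 1)) := by
  have h (a b : ℕ) (h : a ≤ b) : (3 : ℕ) ^ a ≤ 3 ^ b := Nat.pow_le_pow_right (by norm_num) h
  refine ⟨?_, ?_, ?_, ?_⟩
  · simpa using h 1 s hs
  · have := h (s + 2) (2 * s + 1) (by omega)
    rw [pow_add] at this; omega
  · have := h (2 * s + 1 + 1) (2 * s + 1 + s) (by omega)
    rw [pow_succ] at this; omega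
  · have := h (2 * s + 1 + s + 1) (2 * s + 1 + (2 * s + 1)) (by omega)
    rw [pow_succ] at this; omega

theorem pY_eq (s : ℕ) : pY s = X ^ (3 ^ s + 3 ^ 0) - X ^ (3 ^ s + 3 ^ (2 * s + 1))
    + X ^ (3 ^ (2 * s + 1 + s) + 3 ^ (2 * s + 1))
    - X ^ (3 ^ (2 * s + 1 + s) + 3 ^ (2 * s + 1 + (2 * s + 1))) := by
  simp only [pY, q, q0]
  congr 2 <;> ring

theorem pZ_eq (s : ℕ) : pZ s = X ^ (2 * 3 ^ s + 3 ^ 0) - X ^ (2 * 3 ^ s + 3 ^ (2 * s + 1))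
    + X ^ (2 * 3 ^ (2 * s + 1 + s) + 3 ^ (2 * s + 1))
    - X ^ (2 * 3 ^ (2 * s + 1 + s) + 3 ^ (2 * s + 1 + (2 * s + 1))) := by
  simp only [pZ, q, q0]
  congr 2 <;> ring

theorem stmt16 (s : ℕ) (hs : 1 ≤ s) (p : Polynomial F)
    (hp : p = pX ∨ p = pY s ∨ p = pZ s) :
    ell s ^ (2 * q s) * (ell s * hasseDeriv (q s * q0 s + 2 * q s) p - hasseDeriv (q s * q0 s + 1) p)
    = (ell s ^ q s - ell s) * (ell s ^ q s * hasseDeriv (q s * q0 s + q s) p + hasseDeriv (q s * q0 s) p) := by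
  obtain ⟨h1, h2, h3, h4⟩ := arith s hs
  have hqq : q s * q0 s = 3 ^ (2 * s + 1 + s) := by rw [q, q0, pow_add 3 (2 * s + 1) s]
  have hQQ : q s * q s = 3 ^ (2 * s + 1 + (2 * s + 1)) := by rw [q, pow_add 3 (2 * s + 1) (2 * s + 1)]
  have hq : q s = 3 ^ (2 * s + 1) := rfl
  rcases hp with rfl | rfl | rfl
  · have hX (n : ℕ) (hn : 1 < n) : hasseDeriv n pX = 0 :=
      hasseDeriv_X n hn
    rw [hX, hX, hX, hX] <;> first | (rw [hqq]; omega) | simp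
  · have hE := ell_pow s
    rw [hQQ] at hE
    have e1 : hasseDeriv (q s * q0 s + 2 * q s) (pY s) = 0 := by
      rw [hqq, hq, pY_eq]; simp only [map_sub, map_add, hd1]
      simp only [pow_zero, if_true]
      generalize 3 ^ (2 * s + 1 + (2 * s + 1)) = e at *
      generalize 3 ^ (2 * s + 1 + s) = c at *
      generalize 3 ^ (2 * s + 1) = Q at *
      generalize 3 ^ s = a at *
      repeat rw [if_neg (by omega)]
      ring
    have e2 : hasseDeriv (q s * q0 s + 1) (pY s) = 0 := by
      rw [hqq, pY_eq]; simp only [map_sub, map_add, hd1]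
      simp only [pow_zero, if_true]
      generalize 3 ^ (2 * s + 1 + (2 * s + 1)) = e at *
      generalize 3 ^ (2 * s + 1 + s) = c at *
      generalize 3 ^ (2 * s + 1) = Q at *
      generalize 3 ^ s = a at *
      repeat rw [if_neg (by omega)]
      ring
    have e3 : hasseDeriv (q s * q0 s + q s) (pY s) = 1 := by
      rw [hqq, hq, pY_eq]; simp only [map_sub, map_add, hd1]
      simp only [pow_zero, if_true]
      generalize 3 ^ (2 * s + 1 + (2 * s + 1)) = e at *
      generalize 3 ^ (2 * s + 1 + s) = c at *
      generalize 3 ^ (2 * s + 1) = Q at *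
      generalize 3 ^ s = a at *
      repeat rw [if_neg (by omega)]
      ring
    have e4 : hasseDeriv (q s * q0 s) (pY s) = - ell s ^ q s := by
      rw [hE, hqq, hq, pY_eq]; simp only [map_sub, map_add, hd1]
      simp only [pow_zero, if_true]
      generalize 3 ^ (2 * s + 1 + (2 * s + 1)) = e at *
      generalize 3 ^ (2 * s + 1 + s) = c at *
      generalize 3 ^ (2 * s + 1) = Q at *
      generalize 3 ^ s = a at *
      repeat rw [if_neg (by omega)]
      ring
    rw [e1, e2, e3, e4]; ring
  · have hE := ell_pow s
    rw [hQQ] at hE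
    have e1 : hasseDeriv (q s * q0 s + 2 * q s) (pZ s) = 0 := by
      rw [hqq, hq, pZ_eq]; simp only [map_sub, map_add, hd2]
      simp only [pow_zero, if_true]
      generalize 3 ^ (2 * s + 1 + (2 * s + 1)) = e at *
      generalize 3 ^ (2 * s + 1 + s) = c at *
      generalize 3 ^ (2 * s + 1) = Q at *
      generalize 3 ^ s = a at *
      repeat rw [if_neg (by omega)]
      ring
    have e2 : hasseDeriv (q s * q0 s + 1) (pZ s) = 0 := by
      rw [hqq, pZ_eq]; simp only [map_sub, map_add, hd2]
      simp only [pow_zero, if_true]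
      generalize 3 ^ (2 * s + 1 + (2 * s + 1)) = e at *
      generalize 3 ^ (2 * s + 1 + s) = c at *
      generalize 3 ^ (2 * s + 1) = Q at *
      generalize 3 ^ s = a at *
      repeat rw [if_neg (by omega)]
      ring
    have e3 : hasseDeriv (q s * q0 s + q s) (pZ s) = 2 * X ^ (q s * q0 s) := by
      rw [hqq, hq, pZ_eq]; simp only [map_sub, map_add, hd2]
      simp only [pow_zero, if_true]
      generalize 3 ^ (2 * s + 1 + (2 * s + 1)) = e at *
      generalize 3 ^ (2 * s + 1 + s) = c at *
      generalize 3 ^ (2 * s + 1) = Q at *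
      generalize 3 ^ s = a at *
      repeat rw [if_neg (by omega)]
      ring
    have e4 : hasseDeriv (q s * q0 s) (pZ s) = - (2 * X ^ (q s * q0 s) * ell s ^ q s) := by
      rw [hE, hqq, hq, pZ_eq]; simp only [map_sub, map_add, hd2]
      simp only [pow_zero, if_true]
      generalize 3 ^ (2 * s + 1 + (2 * s + 1)) = e at *
      generalize 3 ^ (2 * s + 1 + s) = c at *
      generalize 3 ^ (2 * s + 1) = Q at *
      generalize 3 ^ s = a at *
      repeat rw [if_neg (by omega)]
      ring
    rw [e1, e2, e3, e4]; ring
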